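/- For linear RNNs with input dimension d = 1, define #params(n,L) = (2L−1)n² + (L+1)n. For any depth L ≥ 1 and any hidden size n ≥ 4, there exists a real-valued function f computable as w ∘ h with h ∈ H^RNN_{n,L} and w : ℝ^n → ℝ linear, such that for every depth L̃ < L and every hidden size ñ, if f is computable as w̃ ∘ h̃ with h̃ ∈ H^RNN_{ñ,L̃} and w̃ : ℝ^ñ → ℝ linear, then #params(ñ,L̃) > #params(n,L). -/

import Mathlib

open Matrix

noncomputable section

/-- Extend a finite input sequence (0-indexed: entry `t` is the paper's `x_{t+1}`)
to an infinite one by zero. -/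
def extSeq {d T : ℕ} (x : Fin T → Fin d → ℝ) : ℕ → Fin d → ℝ :=
  fun t => if h : t < T then x ⟨t, h⟩ else 0

/-- A linear RNN of input dimension `d` and hidden size `n` (with ℕ-indexed layer
parameters; a network of depth `L` only uses the parameters of layers `0,…,L-1`).
Layer `0` (the paper's layer 1) reads the `d`-dimensional input through `U0`;
layer `l ≥ 1` reads the previous layer's output through `U l`. -/
structure LinRNN (d n : ℕ) where
  h0 : ℕ → Fin n → ℝ
  U0 : Matrix (Fin n) (Fin d) ℝ
  U : ℕ → Matrix (Fin n) (Fin n) ℝ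
  V : ℕ → Matrix (Fin n) (Fin n) ℝ
  b : ℕ → Fin n → ℝ

/-- `net.state x l t` is the hidden state `h_t^{(l+1)}` (layer `l` 0-indexed, time `t`
with `t = 0` the initial state); the input at paper-time `t` is `x (t-1)`. -/
def LinRNN.state {d n : ℕ} (net : LinRNN d n) (x : ℕ → Fin d → ℝ) : ℕ → ℕ → Fin n → ℝ
  | 0, 0 => net.h0 0
  | 0, t + 1 => net.V 0 *ᵥ LinRNN.state net x 0 t + net.U0 *ᵥ x t + net.b 0
  | l + 1, 0 => net.h0 (l + 1)
  | l + 1, t + 1 =>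
      net.V (l + 1) *ᵥ LinRNN.state net x (l + 1) t
        + net.U (l + 1) *ᵥ LinRNN.state net x l (t + 1) + net.b (l + 1)
  termination_by l t => (l, t)

/-- `H^RNN_{n,L}`: the sequence-to-sequence functions (defined for every length `T`)
computed (at the last layer) by some linear RNN of hidden size `n` and depth `L`. -/
def RNNclass (d n L : ℕ) : Set ((T : ℕ) → (Fin T → Fin d → ℝ) → Fin T → Fin n → ℝ) :=
  { f | ∃ net : LinRNN d n, ∀ (T : ℕ) (x : Fin T → Fin d → ℝ) (t : Fin T),
      f T x t = net.state (extSeq x) (L - 1) ((t : ℕ) + 1) }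

/-- Number of parameters of an `L`-layer linear RNN with hidden size `n` and input
dimension `1`: `#params(n,L) = (2L-1)n² + (L+1)n`. -/
def nparams (n L : ℕ) : ℕ := (2 * L - 1) * n ^ 2 + (L + 1) * n

/-- Real-valued sequence functions computable as `w ∘ h` with
`h ∈ H^RNN_{n,L}` (input dimension `d = 1`) and `w : ℝ^n → ℝ` linear. -/
def RNNRealClass (n L : ℕ) : Set ((T : ℕ) → (Fin T → Fin 1 → ℝ) → Fin T → ℝ) :=
  { f | ∃ (net : LinRNN 1 n) (w : (Fin n → ℝ) →ₗ[ℝ] ℝ),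
      ∀ (T : ℕ) (x : Fin T → Fin 1 → ℝ) (t : Fin T),
        f T x t = w (net.state (extSeq x) (L - 1) ((t : ℕ) + 1)) }

open Polynomial in
/-- If `(1 - X V) v = u` over power series and `q * u` is polynomial, then so is
`(det (1 - X V) * q) * v`. -/
theorem charpolyRev_mul_mem_range {n : ℕ} (V : Matrix (Fin n) (Fin n) ℝ)
    (v u : Fin n → PowerSeries ℝ) (q : ℝ[X])
    (hv : ∀ i, v i = PowerSeries.X * ∑ j, PowerSeries.C (V i j) * v j + u i)
    (hu : ∀ i, (q : PowerSeries ℝ) * u i ∈ (coeToPowerSeries.ringHom (R := ℝ)).range) (i : Fin n) :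
    ((V.charpolyRev * q : ℝ[X]) : PowerSeries ℝ) * v i ∈
      (coeToPowerSeries.ringHom (R := ℝ)).range := by
  set φ := coeToPowerSeries.ringHom (R := ℝ)
  set P : Matrix (Fin n) (Fin n) ℝ[X] := 1 - (X : ℝ[X]) • V.map C with hP
  have hPv : (φ.mapMatrix P) *ᵥ v = u := by
    have hmap : φ.mapMatrix P = 1 - (PowerSeries.X : PowerSeries ℝ) • V.map PowerSeries.C := by
      rw [hP, map_sub, map_one]
      congr 1
      ext1 a b
      simp only [φ, RingHom.mapMatrix_apply, Matrix.map_apply, Matrix.smul_apply, smul_eq_mul,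
        map_mul, coeToPowerSeries.ringHom_apply, coe_X, coe_C]
    rw [hmap, Matrix.sub_mulVec, Matrix.one_mulVec, Matrix.smul_mulVec]
    funext a
    rw [Pi.sub_apply, sub_eq_iff_eq_add', hv a]
    simp [Matrix.mulVec, dotProduct]
  have hdet : φ V.charpolyRev * v i = ((φ.mapMatrix P).adjugate *ᵥ u) i := by
    rw [← hPv, Matrix.mulVec_mulVec, Matrix.adjugate_mul, Matrix.smul_mulVec, Matrix.one_mulVec,
      ← RingHom.map_det]
    rfl
  have hcomm : ((V.charpolyRev * q : ℝ[X]) : PowerSeries ℝ) * v i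
      = ∑ j, φ (P.adjugate i j) * ((q : PowerSeries ℝ) * u j) := by
    rw [coe_mul, mul_right_comm]
    change φ V.charpolyRev * v i * _ = _
    rw [hdet, ← RingHom.map_adjugate]
    simp only [Matrix.mulVec, dotProduct, Finset.sum_mul, RingHom.mapMatrix_apply,
      Matrix.map_apply]
    exact Finset.sum_congr rfl fun j _ => by ring
  rw [hcomm]
  exact Subring.sum_mem _ fun j _ => Subring.mul_mem _ ⟨_, rfl⟩ (hu j)

open Polynomial in
theorem natDegree_charpolyRev_le {n : ℕ} (V : Matrix (Fin n) (Fin n) ℝ) :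
    V.charpolyRev.natDegree ≤ n := by
  rw [← Matrix.reverse_charpoly]
  refine (reverse_natDegree_le _).trans ?_
  simp [Matrix.charpoly_natDegree_eq_dim]

theorem charpolyRev_ne_zero {n : ℕ} (V : Matrix (Fin n) (Fin n) ℝ) : V.charpolyRev ≠ 0 := by
  intro h
  simpa [h] using Matrix.eval_charpolyRev (M := V)

namespace LinRNN

variable {n : ℕ}

/-- The input sequence `1, 0, 0, …`. -/
def impulse : ℕ → Fin 1 → ℝ := fun t _ => if t = 0 then 1 else 0

theorem state_zero_succ (net : LinRNN 1 n) (x : ℕ → Fin 1 → ℝ) (t : ℕ) :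
    net.state x 0 (t + 1) = net.V 0 *ᵥ net.state x 0 t + net.U0 *ᵥ x t + net.b 0 := by
  rw [state]

theorem state_succ_succ (net : LinRNN 1 n) (x : ℕ → Fin 1 → ℝ) (l t : ℕ) :
    net.state x (l + 1) (t + 1) = net.V (l + 1) *ᵥ net.state x (l + 1) t
      + net.U (l + 1) *ᵥ net.state x l (t + 1) + net.b (l + 1) := by
  rw [state]

/-- Generating function of the response of layer `l` to an impulse. -/
def response (net : LinRNN 1 n) (l : ℕ) (i : Fin n) : PowerSeries ℝ :=
  PowerSeries.mk fun t => net.state impulse l (t + 1) i - net.state 0 l (t + 1) i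

theorem response_zero (net : LinRNN 1 n) (i : Fin n) :
    net.response 0 i = PowerSeries.X * ∑ j, PowerSeries.C (net.V 0 i j) * net.response 0 j
      + PowerSeries.C (net.U0 i 0) := by
  ext t
  cases t with
  | zero => simp [response, state, impulse, Matrix.mulVec, dotProduct]
  | succ t =>
    rw [map_add, PowerSeries.coeff_succ_X_mul]
    simp only [response, PowerSeries.coeff_mk, map_sum, PowerSeries.coeff_C_mul,
      PowerSeries.coeff_C]
    rw [state_zero_succ net impulse (t + 1), state_zero_succ net 0 (t + 1)]
    simp [impulse, Matrix.mulVec, dotProduct, mul_sub]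

theorem response_succ (net : LinRNN 1 n) (l : ℕ) (i : Fin n) :
    net.response (l + 1) i =
      PowerSeries.X * ∑ j, PowerSeries.C (net.V (l + 1) i j) * net.response (l + 1) j
      + ∑ j, PowerSeries.C (net.U (l + 1) i j) * net.response l j := by
  ext t
  cases t with
  | zero =>
    simp only [response, map_add, PowerSeries.coeff_zero_X_mul, PowerSeries.coeff_mk, map_sum,
      PowerSeries.coeff_C_mul]
    rw [state, state, state, state]
    simp [Matrix.mulVec, dotProduct, mul_sub]
  | succ t =>
    rw [map_add, PowerSeries.coeff_succ_X_mul]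
    simp only [response, PowerSeries.coeff_mk, map_sum, PowerSeries.coeff_C_mul]
    rw [state_succ_succ net impulse l (t + 1), state_succ_succ net 0 l (t + 1)]
    simp [Matrix.mulVec, dotProduct, mul_sub]
    ring

open Polynomial in
/-- The impulse response of layer `l` is rational, with denominator of degree at most
`n * (l + 1)`. -/
theorem exists_denominator (net : LinRNN 1 n) (l : ℕ) :
    ∃ q : ℝ[X], q ≠ 0 ∧ q.natDegree ≤ n * (l + 1) ∧
      ∀ i, (q : PowerSeries ℝ) * net.response l i ∈ (coeToPowerSeries.ringHom (R := ℝ)).range := by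
  induction l with
  | zero =>
    refine ⟨(net.V 0).charpolyRev * 1, by simpa using charpolyRev_ne_zero _,
      by simpa using natDegree_charpolyRev_le _, ?_⟩
    exact charpolyRev_mul_mem_range _ _ _ _ net.response_zero fun i =>
      ⟨C (net.U0 i 0), by simp⟩
  | succ l ih =>
    obtain ⟨q, hq, hdeg, hmem⟩ := ih
    refine ⟨(net.V (l + 1)).charpolyRev * q, mul_ne_zero (charpolyRev_ne_zero _) hq, ?_, ?_⟩
    · have := natDegree_charpolyRev_le (net.V (l + 1))
      refine natDegree_mul_le.trans ?_
      rw [Nat.mul_succ n (l + 1)]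
      omega
    · refine charpolyRev_mul_mem_range _ _ _ _ (net.response_succ l) fun i => ?_
      rw [Finset.mul_sum]
      refine Subring.sum_mem _ fun j _ => ?_
      rw [mul_left_comm]
      exact Subring.mul_mem _ ⟨C (net.U (l + 1) i j), by simp⟩ (hmem j)

/-- The network all of whose layers rotate their state cyclically and add the previous layer's
coordinate `0` to their own coordinate `0`. -/
def rotation (m : ℕ) : LinRNN 1 (m + 1) where
  h0 := 0
  U0 := fun i _ => if i = 0 then 1 else 0
  U := fun _ i j => if i = 0 ∧ j = 0 then 1 else 0
  V := fun _ i j => if j = i - 1 then 1 else 0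
  b := 0

/-- A solution of the cyclic-shift equation driven at coordinate `0` by `u`. -/
theorem one_sub_X_pow_mul_of_rotation {m : ℕ} (v : Fin (m + 1) → PowerSeries ℝ)
    (u : PowerSeries ℝ)
    (hv : ∀ i, v i = PowerSeries.X * v (i - 1) + if i = 0 then u else 0) :
    (1 - PowerSeries.X ^ (m + 1)) * v 0 = u := by
  have hpow : ∀ k (hk : k < m + 1), v ⟨k, hk⟩ = PowerSeries.X ^ k * v 0 := by
    intro k
    induction k with
    | zero => intro _; rw [pow_zero, one_mul]; rfl
    | succ k ih =>
      intro hk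
      have hpred : (⟨k + 1, hk⟩ : Fin (m + 1)) - 1 = ⟨k, by omega⟩ := by
        rw [sub_eq_iff_eq_add]
        ext
        rw [Fin.val_add_one_of_lt (by rw [Fin.lt_def]; simp; omega)]
      rw [hv, hpred, ih, if_neg (by simp [Fin.ext_iff]), pow_succ']
      ring
  have h0 := hv 0
  have hlast : (0 : Fin (m + 1)) - 1 = ⟨m, by omega⟩ := by
    rw [sub_eq_iff_eq_add]
    exact (Fin.last_add_one m).symm
  rw [hlast, hpow m, if_pos rfl] at h0
  linear_combination h0

theorem rotation_response (m l : ℕ) :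
    (1 - PowerSeries.X ^ (m + 1) : PowerSeries ℝ) ^ (l + 1) * (rotation m).response l 0 = 1 := by
  induction l with
  | zero =>
    rw [zero_add, pow_one]
    refine one_sub_X_pow_mul_of_rotation _ _ fun i => ?_
    rw [response_zero]
    simp [rotation, apply_ite PowerSeries.C, ite_mul]
  | succ l ih =>
    have hstep : (1 - PowerSeries.X ^ (m + 1) : PowerSeries ℝ) * (rotation m).response (l + 1) 0
        = (rotation m).response l 0 := by
      refine one_sub_X_pow_mul_of_rotation _ _ fun i => ?_
      rw [response_succ]
      by_cases hi : i = 0 <;> simp [rotation, apply_ite PowerSeries.C, ite_mul, hi]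
    rw [pow_succ, mul_assoc, hstep, ih]

end LinRNN

theorem extSeq_impulse (t : ℕ) :
    extSeq (T := t + 1) (fun s => LinRNN.impulse s) = LinRNN.impulse := by
  funext s i
  by_cases h : s < t + 1
  · simp [extSeq, h]
  · have : s ≠ 0 := by omega
    simp [extSeq, h, LinRNN.impulse, this]

theorem extSeq_zero (T : ℕ) : extSeq (0 : Fin T → Fin 1 → ℝ) = 0 := by
  funext s
  simp [extSeq]

open Polynomial in
/-- A network of width `nt` computing the same function as the rotation network has at least as
many state coordinates. -/
theorem mul_le_mul_of_computes_rotation {m l nt k : ℕ} (net : LinRNN 1 nt)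
    (w : (Fin nt → ℝ) →ₗ[ℝ] ℝ)
    (h : ∀ (T : ℕ) (x : Fin T → Fin 1 → ℝ) (t : Fin T),
      (LinRNN.rotation m).state (extSeq x) l ((t : ℕ) + 1) 0
        = w (net.state (extSeq x) k ((t : ℕ) + 1))) :
    (m + 1) * (l + 1) ≤ nt * (k + 1) := by
  have hresp : (LinRNN.rotation m).response l 0
      = ∑ j, PowerSeries.C (w (Pi.single j 1)) * net.response k j := by
    ext t
    have h1 := h (t + 1) (fun s => LinRNN.impulse s) (Fin.last t)
    have h0 := h (t + 1) 0 (Fin.last t)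
    rw [extSeq_impulse, Fin.val_last] at h1
    rw [extSeq_zero, Fin.val_last] at h0
    simp only [LinRNN.response, PowerSeries.coeff_mk, map_sum, PowerSeries.coeff_C_mul]
    rw [h1, h0, LinearMap.pi_apply_eq_sum_univ w, LinearMap.pi_apply_eq_sum_univ w,
      ← Finset.sum_sub_distrib]
    refine Finset.sum_congr rfl fun j _ => ?_
    have hs : (fun i => if j = i then (1 : ℝ) else 0) = Pi.single j 1 := by
      funext i
      simp [Pi.single_apply, eq_comm]
    simp only [hs, smul_eq_mul]
    ring
  obtain ⟨q, hq, hdeg, hmem⟩ := net.exists_denominator k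
  obtain ⟨r, hr⟩ : (q : PowerSeries ℝ) * (LinRNN.rotation m).response l 0 ∈
      (coeToPowerSeries.ringHom (R := ℝ)).range := by
    rw [hresp, Finset.mul_sum]
    refine Subring.sum_mem _ fun j _ => ?_
    rw [mul_left_comm]
    exact Subring.mul_mem _ ⟨C (w (Pi.single j 1)), by simp⟩ (hmem j)
  have hqr : q = (1 - X ^ (m + 1)) ^ (l + 1) * r := by
    apply coe_injective ℝ
    have hrot := LinRNN.rotation_response m l
    rw [coeToPowerSeries.ringHom_apply] at hr
    push_cast
    rw [hr, mul_left_comm, hrot, mul_one]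
  have hD : ((1 - X ^ (m + 1) : ℝ[X]) ^ (l + 1)).natDegree = (m + 1) * (l + 1) := by
    have h1 : (1 - X ^ (m + 1) : ℝ[X]).natDegree = m + 1 := by
      rw [← neg_sub, natDegree_neg, ← C_1, natDegree_X_pow_sub_C]
    rw [natDegree_pow, h1, mul_comm]
  calc (m + 1) * (l + 1) = ((1 - X ^ (m + 1) : ℝ[X]) ^ (l + 1)).natDegree := hD.symm
    _ ≤ q.natDegree := natDegree_le_of_dvd ⟨r, hqr⟩ hq
    _ ≤ nt * (k + 1) := hdeg

/-- Among networks with at least a given number of state coordinates, deeper is cheaper. -/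
theorem nparams_lt_nparams {n nt k l : ℕ} (hn : 0 < n) (hk : 1 ≤ k) (hkl : k < l)
    (h : n * l ≤ nt * k) : nparams n l < nparams nt k := by
  obtain ⟨a, rfl⟩ : ∃ a, k = a + 1 := ⟨k - 1, by omega⟩
  obtain ⟨c, rfl⟩ : ∃ c, l = a + 1 + (c + 1) := ⟨l - (a + 1) - 1, by omega⟩
  have e1 : 2 * (a + 1 + (c + 1)) - 1 = 2 * a + 2 * c + 3 := by omega
  have e2 : 2 * (a + 1) - 1 = 2 * a + 1 := by omega
  rw [nparams, nparams, e1, e2]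
  refine lt_of_mul_lt_mul_left (a := (a + 1) ^ 2) ?_ (by positivity)
  have hsq : (n * (a + 1 + (c + 1))) ^ 2 ≤ (nt * (a + 1)) ^ 2 := Nat.pow_le_pow_left h 2
  calc (a + 1) ^ 2 * ((2 * a + 2 * c + 3) * n ^ 2 + (a + 1 + (c + 1) + 1) * n)
      < (2 * a + 1) * (n * (a + 1 + (c + 1))) ^ 2
        + (a + 1 + 1) * (a + 1) * (n * (a + 1 + (c + 1))) := by
        have : 0 < (a + 1) * (c + 1) * n := by positivity
        have h2 : 0 ≤ n ^ 2 * (c + 1) * (2 * a ^ 2 + 2 * a * c + 4 * a + c + 1) := Nat.zero_le _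
        zify at *
        nlinarith
    _ ≤ (2 * a + 1) * (nt * (a + 1)) ^ 2 + (a + 1 + 1) * (a + 1) * (nt * (a + 1)) := by gcongr
    _ = (a + 1) ^ 2 * ((2 * a + 1) * nt ^ 2 + (a + 1 + 1) * nt) := by ring

/-- For any depth `L ≥ 1` and hidden size `n ≥ 4`, there is a function
computable by a depth-`L`, width-`n` linear RNN (with a linear readout) such that every
shallower RNN (depth `L̃ < L`, any width `ñ`) computing it must use strictly more
parameters: `#params(ñ,L̃) > #params(n,L)`. -/
theorem depth_is_parameter_efficient (L n : ℕ) (hL : 1 ≤ L) (hn : 4 ≤ n) :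
    ∃ f ∈ RNNRealClass n L,
      ∀ (nt Lt : ℕ), 1 ≤ Lt → Lt < L →
        f ∈ RNNRealClass nt Lt → nparams n L < nparams nt Lt := by
  obtain ⟨m, rfl⟩ : ∃ m, n = m + 1 := ⟨n - 1, by omega⟩
  refine ⟨fun T x t => (LinRNN.rotation m).state (extSeq x) (L - 1) ((t : ℕ) + 1) 0,
    ⟨LinRNN.rotation m, LinearMap.proj 0, fun _ _ _ => rfl⟩, ?_⟩
  rintro nt Lt hLt hlt ⟨net, w, hw⟩
  have hle := mul_le_mul_of_computes_rotation net w hw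
  rw [Nat.sub_add_cancel hL, Nat.sub_add_cancel hLt] at hle
  exact nparams_lt_nparams m.succ_pos hLt hlt hle

end
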